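/- arXiv:nlin/0310005 — 11 statements merged into one kernel-verified Lean document; each statement's English description precedes it below -/
import Mathlib

section
/- Let n ≥ 1 and let F, G : (Fin n → ℂ) × (Fin n → ℂ) → ℂ be differentiable over ℂ (holomorphic). Assume that the complex canonical Poisson bracket {F,G}_ℂ vanishes identically. Then the three real Poisson brackets {Re F, Re G}_0, {Re F, Im G}_0 and {Im F, Im G}_0 (taken with respect to the real symplectic form ω_0 = Re ω^ℂ) vanish identically on (Fin n → ℂ) × (Fin n → ℂ). -/
/-- The complex canonical Poisson bracket of two functions on
`(Fin n → ℂ) × (Fin n → ℂ)` (coordinates `(p, q)`), built from the complex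
directional derivatives along the coordinate directions. -/
noncomputable def complexPB (n : ℕ) (F G : (Fin n → ℂ) × (Fin n → ℂ) → ℂ)
    (z : (Fin n → ℂ) × (Fin n → ℂ)) : ℂ :=
  ∑ s : Fin n,
    (fderiv ℂ F z (Pi.single s 1, 0) * fderiv ℂ G z (0, Pi.single s 1)
      - fderiv ℂ F z (0, Pi.single s 1) * fderiv ℂ G z (Pi.single s 1, 0))

/-- The real Poisson bracket associated with the symplectic form
`ω₀ = Re ω^ℂ = Σ (dp_{s,0} ∧ dq_{s,0} − dp_{s,1} ∧ dq_{s,1})`, for real-valued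
functions on `(Fin n → ℂ) × (Fin n → ℂ)`; the directions `e_s` and `i·e_s`
encode the real and imaginary coordinate directions. -/
noncomputable def realPB0 (n : ℕ) (A B : (Fin n → ℂ) × (Fin n → ℂ) → ℝ)
    (z : (Fin n → ℂ) × (Fin n → ℂ)) : ℝ :=
  ∑ s : Fin n,
    (fderiv ℝ A z (Pi.single s 1, 0) * fderiv ℝ B z (0, Pi.single s 1)
      - fderiv ℝ A z (0, Pi.single s 1) * fderiv ℝ B z (Pi.single s 1, 0)
      - fderiv ℝ A z (Pi.single s Complex.I, 0) * fderiv ℝ B z (0, Pi.single s Complex.I)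
      + fderiv ℝ A z (0, Pi.single s Complex.I) * fderiv ℝ B z (Pi.single s Complex.I, 0))

theorem fderiv_real_re_apply {E : Type*} [NormedAddCommGroup E] [NormedSpace ℂ E]
    {F : E → ℂ} {z : E} (hF : DifferentiableAt ℂ F z) (v : E) :
    fderiv ℝ (fun w => (F w).re) z v = (fderiv ℂ F z v).re := by
  have h := Complex.reCLM.hasFDerivAt.comp z (hF.hasFDerivAt.restrictScalars ℝ)
  exact congrArg (fun L : E →L[ℝ] ℝ => L v) h.fderiv

theorem fderiv_real_im_apply {E : Type*} [NormedAddCommGroup E] [NormedSpace ℂ E]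
    {F : E → ℂ} {z : E} (hF : DifferentiableAt ℂ F z) (v : E) :
    fderiv ℝ (fun w => (F w).im) z v = (fderiv ℂ F z v).im := by
  have h := Complex.imCLM.hasFDerivAt.comp z (hF.hasFDerivAt.restrictScalars ℝ)
  exact congrArg (fun L : E →L[ℝ] ℝ => L v) h.fderiv

theorem map_single_I_left {n : ℕ} (L : (Fin n → ℂ) × (Fin n → ℂ) →L[ℂ] ℂ) (s : Fin n) :
    L (Pi.single s Complex.I, 0) = Complex.I * L (Pi.single s 1, 0) := by
  rw [← smul_eq_mul, ← map_smul, Prod.smul_mk, ← Pi.single_smul]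
  simp

theorem map_single_I_right {n : ℕ} (L : (Fin n → ℂ) × (Fin n → ℂ) →L[ℂ] ℂ) (s : Fin n) :
    L (0, Pi.single s Complex.I) = Complex.I * L (0, Pi.single s 1) := by
  rw [← smul_eq_mul, ← map_smul, Prod.smul_mk, ← Pi.single_smul]
  simp

section
variable {n : ℕ} {F G : (Fin n → ℂ) × (Fin n → ℂ) → ℂ} {z : (Fin n → ℂ) × (Fin n → ℂ)}

theorem realPB0_re_re (hF : DifferentiableAt ℂ F z) (hG : DifferentiableAt ℂ G z) :
    realPB0 n (fun w => (F w).re) (fun w => (G w).re) z = (complexPB n F G z).re := by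
  rw [realPB0, complexPB, Complex.re_sum]
  refine Finset.sum_congr rfl fun s _ => ?_
  simp only [fderiv_real_re_apply hF, fderiv_real_re_apply hG, map_single_I_left,
    map_single_I_right, Complex.sub_re, Complex.mul_re, Complex.I_re, Complex.I_im]
  ring

theorem realPB0_re_im (hF : DifferentiableAt ℂ F z) (hG : DifferentiableAt ℂ G z) :
    realPB0 n (fun w => (F w).re) (fun w => (G w).im) z = (complexPB n F G z).im := by
  rw [realPB0, complexPB, Complex.im_sum]
  refine Finset.sum_congr rfl fun s _ => ?_
  simp only [fderiv_real_re_apply hF, fderiv_real_im_apply hG, map_single_I_left,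
    map_single_I_right, Complex.I_mul_re, Complex.sub_im, Complex.mul_im, Complex.I_re, Complex.I_im]
  ring

theorem realPB0_im_im (hF : DifferentiableAt ℂ F z) (hG : DifferentiableAt ℂ G z) :
    realPB0 n (fun w => (F w).im) (fun w => (G w).im) z = -(complexPB n F G z).re := by
  rw [realPB0, complexPB, Complex.re_sum, ← Finset.sum_neg_distrib]
  refine Finset.sum_congr rfl fun s _ => ?_
  simp only [fderiv_real_im_apply hF, fderiv_real_im_apply hG, map_single_I_left,
    map_single_I_right, Complex.I_mul_im, Complex.sub_re, Complex.mul_re]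
  ring

end

/-- If `F`, `G` are holomorphic and their complex canonical Poisson bracket vanishes
identically, then the three real brackets `{Re F, Re G}₀`, `{Re F, Im G}₀` and
`{Im F, Im G}₀` (with respect to `ω₀ = Re ω^ℂ`) vanish identically. -/
theorem real_brackets_vanish_of_complex_bracket_vanishes
    (n : ℕ) (hn : 1 ≤ n) (F G : (Fin n → ℂ) × (Fin n → ℂ) → ℂ)
    (hF : Differentiable ℂ F) (hG : Differentiable ℂ G)
    (hFG : ∀ z, complexPB n F G z = 0) :
    ∀ z, realPB0 n (fun w => (F w).re) (fun w => (G w).re) z = 0 ∧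
      realPB0 n (fun w => (F w).re) (fun w => (G w).im) z = 0 ∧
      realPB0 n (fun w => (F w).im) (fun w => (G w).im) z = 0 := by
  intro z
  rw [realPB0_re_re (hF z) (hG z), realPB0_re_im (hF z) (hG z), realPB0_im_im (hF z) (hG z), hFG z]
  simp
end

section
/- Let n ≥ 1, let ε : Fin n → ℝ satisfy ε_k ∈ {+1, −1} for all k, and let C_ε(p,q)_k = (ε_k p_k, ε_k q_k) be the associated linear involution of (Fin n → ℂ) × (Fin n → ℂ), with σ the componentwise complex conjugation. Let H, F : (Fin n → ℂ) × (Fin n → ℂ) → ℂ be holomorphic, with H satisfying H ∘ σ = conj ∘ H and H ∘ C_ε = H, and suppose {H, F}_ℂ = 0 identically. Define G(z) = conj(F(C_ε(σ(z)))). Then G is holomorphic and {H, G}_ℂ = 0 identically. -/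
/-- The linear involution `C_ε (p,q)_k = (ε_k p_k, ε_k q_k)`. -/
def Ceps (n : ℕ) (ε : Fin n → ℝ) (z : (Fin n → ℂ) × (Fin n → ℂ)) :
    (Fin n → ℂ) × (Fin n → ℂ) :=
  (fun k => (ε k : ℂ) * z.1 k, fun k => (ε k : ℂ) * z.2 k)

/-- Componentwise complex conjugation `σ`. -/
def sigmaConj (n : ℕ) (z : (Fin n → ℂ) × (Fin n → ℂ)) :
    (Fin n → ℂ) × (Fin n → ℂ) :=
  (fun k => starRingEnd ℂ (z.1 k), fun k => starRingEnd ℂ (z.2 k))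

/-- The involution `C_ε` as a continuous `ℂ`-linear map. -/
noncomputable def CepsCLM (n : ℕ) (ε : Fin n → ℝ) :
    ((Fin n → ℂ) × (Fin n → ℂ)) →L[ℂ] (Fin n → ℂ) × (Fin n → ℂ) :=
  LinearMap.toContinuousLinearMap
    { toFun := Ceps n ε
      map_add' := fun x y => by ext k <;> simp [Ceps, mul_add]
      map_smul' := fun c x => by ext k <;> simp [Ceps, mul_left_comm] }

theorem hasFDerivAt_conj_comp_Ceps_sigmaConj {n : ℕ} (ε : Fin n → ℝ)
    {F : (Fin n → ℂ) × (Fin n → ℂ) → ℂ} (hF : Differentiable ℂ F)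
    (z : (Fin n → ℂ) × (Fin n → ℂ)) :
    HasFDerivAt (fun w => starRingEnd ℂ (F (Ceps n ε (sigmaConj n w))))
      ((starL ℂ).toContinuousLinearMap.comp <|
        ((fderiv ℂ F (Ceps n ε (sigmaConj n z))).comp (CepsCLM n ε)).comp
          (starL ℂ).toContinuousLinearMap) z := by
  have h : HasFDerivAt (F ∘ CepsCLM n ε)
      ((fderiv ℂ F (Ceps n ε (sigmaConj n z))).comp (CepsCLM n ε)) (star z) :=
    HasFDerivAt.comp (star z) (hF (Ceps n ε (sigmaConj n z))).hasFDerivAt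
      (CepsCLM n ε).hasFDerivAt
  have h' := h.star_star
  rw [star_star] at h'
  exact h'

theorem fderiv_conj_comp_Ceps_sigmaConj {n : ℕ} (ε : Fin n → ℝ)
    {F : (Fin n → ℂ) × (Fin n → ℂ) → ℂ} (hF : Differentiable ℂ F)
    (z v : (Fin n → ℂ) × (Fin n → ℂ)) :
    fderiv ℂ (fun w => starRingEnd ℂ (F (Ceps n ε (sigmaConj n w)))) z v =
      starRingEnd ℂ (fderiv ℂ F (Ceps n ε (sigmaConj n z)) (Ceps n ε (sigmaConj n v))) := by
  rw [(hasFDerivAt_conj_comp_Ceps_sigmaConj ε hF z).fderiv]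
  rfl

theorem Ceps_sigmaConj_single_zero {n : ℕ} (ε : Fin n → ℝ) (s : Fin n) :
    Ceps n ε (sigmaConj n (Pi.single s 1, 0)) = (ε s : ℂ) • (Pi.single s 1, 0) := by
  ext k
  · by_cases hk : k = s
    · subst hk; simp [Ceps, sigmaConj]
    · simp [Ceps, sigmaConj, hk]
  · simp [Ceps, sigmaConj]

theorem Ceps_sigmaConj_zero_single {n : ℕ} (ε : Fin n → ℝ) (s : Fin n) :
    Ceps n ε (sigmaConj n (0, Pi.single s 1)) = (ε s : ℂ) • (0, Pi.single s 1) := by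
  ext k
  · simp [Ceps, sigmaConj]
  · by_cases hk : k = s
    · subst hk; simp [Ceps, sigmaConj]
    · simp [Ceps, sigmaConj, hk]

/-- The antiholomorphic involution `C_ε ∘ σ` intertwines the Poisson bracket with its conjugate. -/
theorem complexPB_conj_comp_Ceps_sigmaConj {n : ℕ} {ε : Fin n → ℝ}
    (hε : ∀ k, ε k = 1 ∨ ε k = -1) {H F : (Fin n → ℂ) × (Fin n → ℂ) → ℂ}
    (hH : Differentiable ℂ H) (hF : Differentiable ℂ F) (z : (Fin n → ℂ) × (Fin n → ℂ)) :
    complexPB n (fun w => starRingEnd ℂ (H (Ceps n ε (sigmaConj n w))))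
        (fun w => starRingEnd ℂ (F (Ceps n ε (sigmaConj n w)))) z =
      starRingEnd ℂ (complexPB n H F (Ceps n ε (sigmaConj n z))) := by
  simp only [complexPB, map_sum]
  refine Finset.sum_congr rfl fun s _ => ?_
  simp only [fderiv_conj_comp_Ceps_sigmaConj ε hH, fderiv_conj_comp_Ceps_sigmaConj ε hF,
    Ceps_sigmaConj_single_zero, Ceps_sigmaConj_zero_single, map_smul, smul_eq_mul, map_mul,
    map_sub, Complex.conj_ofReal]
  rcases hε s with h | h <;> simp [h]

/-- If `H`, `F` are holomorphic, `H` satisfies `H ∘ σ = conj ∘ H` and `H ∘ C_ε = H`,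
and `{H, F}_ℂ = 0` identically, then `G(z) = conj (F (C_ε (σ z)))` is holomorphic
and `{H, G}_ℂ = 0` identically. -/
theorem involution_image_of_integral_is_integral
    (n : ℕ) (hn : 1 ≤ n) (ε : Fin n → ℝ) (hε : ∀ k, ε k = 1 ∨ ε k = -1)
    (H F : (Fin n → ℂ) × (Fin n → ℂ) → ℂ)
    (hH : Differentiable ℂ H) (hF : Differentiable ℂ F)
    (hHσ : ∀ z, H (sigmaConj n z) = starRingEnd ℂ (H z))
    (hHC : ∀ z, H (Ceps n ε z) = H z)
    (hHF : ∀ z, complexPB n H F z = 0) :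
    Differentiable ℂ (fun z => starRingEnd ℂ (F (Ceps n ε (sigmaConj n z)))) ∧
      ∀ z, complexPB n H (fun w => starRingEnd ℂ (F (Ceps n ε (sigmaConj n w)))) z = 0 := by
  refine ⟨fun z => (hasFDerivAt_conj_comp_Ceps_sigmaConj ε hF z).differentiableAt, fun z => ?_⟩
  have hHinv : (fun w => starRingEnd ℂ (H (Ceps n ε (sigmaConj n w)))) = H := by
    funext w
    rw [hHC, hHσ, Complex.conj_conj]
  have h := complexPB_conj_comp_Ceps_sigmaConj hε hH hF z
  rwa [hHinv, hHF, map_zero] at h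
end

section
/- Let n ≥ 1, ε : Fin n → ℝ with ε_k ∈ {+1, −1}, and let H : (Fin n → ℂ) × (Fin n → ℂ) → ℂ be holomorphic with H ∘ σ = conj ∘ H and H ∘ C_ε = H. Let z = (p,q) be a fixed point of C̃_ε = C_ε ∘ σ, i.e. ε_k · conj(p_k) = p_k and ε_k · conj(q_k) = q_k for all k. Then for every k the complex partial derivatives of H at z satisfy ∂H/∂p_k(z) = ε_k · conj(∂H/∂p_k(z)) and ∂H/∂q_k(z) = ε_k · conj(∂H/∂q_k(z)); in particular the derivatives along directions with ε_k = +1 are real and those along directions with ε_k = −1 are purely imaginary (this is the statement that the first derivatives of H_0 = Re H in the directions transverse to the real form M_ℝ vanish on M_ℝ). -/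
/-- If `H (z + e t v) = conj (H (z + t v))` for all real `t`, then the derivative of `H` at `z`
along `v` satisfies `e ∂ᵥH = conj (∂ᵥH)`. -/
theorem real_mul_fderiv_eq_conj_of_forall_line {E : Type*} [NormedAddCommGroup E]
    [NormedSpace ℂ E] {H : E → ℂ} {z v : E} {e : ℝ} (hH : DifferentiableAt ℂ H z)
    (h : ∀ t : ℝ, H (z + ((e * t : ℝ) : ℂ) • v) = starRingEnd ℂ (H (z + (t : ℂ) • v))) :
    (e : ℂ) * fderiv ℂ H z v = starRingEnd ℂ (fderiv ℂ H z v) := by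
  have hline : HasDerivAt (fun t : ℝ => H (z + (t : ℂ) • v)) (fderiv ℂ H z v) 0 := by
    have h₀ : HasDerivAt (fun t : ℂ => H (z + t • v)) (fderiv ℂ H z v) ((0 : ℝ) : ℂ) := by
      simpa [HasLineDerivAt] using hH.hasFDerivAt.hasLineDerivAt v
    exact h₀.comp_ofReal
  have hscale : HasDerivAt (fun t : ℝ => H (z + ((e * t : ℝ) : ℂ) • v))
      (e • fderiv ℂ H z v) 0 := by
    have he : HasDerivAt (fun t : ℝ => e * t) e 0 := by
      simpa using (hasDerivAt_id (0 : ℝ)).const_mul e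
    exact HasDerivAt.scomp_of_eq (0 : ℝ) hline he (by simp)
  have hconj : HasDerivAt (fun t : ℝ => starRingEnd ℂ (H (z + (t : ℂ) • v)))
      (starRingEnd ℂ (fderiv ℂ H z v)) 0 := hline.star
  rw [← Complex.real_smul]
  exact hscale.unique (by simpa only [h] using hconj)

/-- A function invariant under `C_ε` and equivariant under conjugation has
`e ∂ᵥH = conj (∂ᵥH)` at fixed points of `C_ε ∘ σ`, for every `v` with `C_ε (σ v) = e v`. -/
theorem real_mul_fderiv_eq_conj_of_eigenvector {n : ℕ} {ε : Fin n → ℝ}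
    {H : (Fin n → ℂ) × (Fin n → ℂ) → ℂ}
    (hHσ : ∀ z, H (sigmaConj n z) = starRingEnd ℂ (H z)) (hHC : ∀ z, H (Ceps n ε z) = H z)
    {z v : (Fin n → ℂ) × (Fin n → ℂ)} (hH : DifferentiableAt ℂ H z)
    (hz : Ceps n ε (sigmaConj n z) = z) {e : ℝ} (hv : Ceps n ε (sigmaConj n v) = (e : ℂ) • v) :
    (e : ℂ) * fderiv ℂ H z v = starRingEnd ℂ (fderiv ℂ H z v) := by
  refine real_mul_fderiv_eq_conj_of_forall_line hH fun t => ?_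
  have hlin : Ceps n ε (sigmaConj n (z + (t : ℂ) • v)) =
      Ceps n ε (sigmaConj n z) + (t : ℂ) • Ceps n ε (sigmaConj n v) := by
    ext j <;> simp [Ceps, sigmaConj] <;> ring
  rw [← hHσ, ← hHC (sigmaConj n _), hlin, hz, hv, smul_smul, Complex.ofReal_mul, mul_comm (e : ℂ)]

/-- At each fixed point of `C̃_ε = C_ε ∘ σ`, the complex partial derivatives of a
holomorphic `H` with `H ∘ σ = conj ∘ H` and `H ∘ C_ε = H` satisfy
`∂H/∂p_k = ε_k conj(∂H/∂p_k)` and `∂H/∂q_k = ε_k conj(∂H/∂q_k)`: derivatives along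
`ε_k = +1` directions are real and those along `ε_k = −1` directions are purely
imaginary (the transverse first derivatives of `H₀ = Re H` vanish on `M_ℝ`). -/
theorem derivatives_reality_on_real_form
    (n : ℕ) (hn : 1 ≤ n) (ε : Fin n → ℝ) (hε : ∀ k, ε k = 1 ∨ ε k = -1)
    (H : (Fin n → ℂ) × (Fin n → ℂ) → ℂ) (hH : Differentiable ℂ H)
    (hHσ : ∀ z, H (sigmaConj n z) = starRingEnd ℂ (H z))
    (hHC : ∀ z, H (Ceps n ε z) = H z)
    (z : (Fin n → ℂ) × (Fin n → ℂ))
    (hz : ∀ k, (ε k : ℂ) * starRingEnd ℂ (z.1 k) = z.1 k ∧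
      (ε k : ℂ) * starRingEnd ℂ (z.2 k) = z.2 k) :
    ∀ k,
      fderiv ℂ H z (Pi.single k 1, 0)
        = (ε k : ℂ) * starRingEnd ℂ (fderiv ℂ H z (Pi.single k 1, 0)) ∧
      fderiv ℂ H z (0, Pi.single k 1)
        = (ε k : ℂ) * starRingEnd ℂ (fderiv ℂ H z (0, Pi.single k 1)) := by
  have hfix : Ceps n ε (sigmaConj n z) = z :=
    Prod.ext (funext fun j => (hz j).1) (funext fun j => (hz j).2)
  intro k
  have hsq : (ε k : ℂ) * ε k = 1 := by
    rcases hε k with h | h <;> simp [h]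
  have hsingle (j : Fin n) : (ε j : ℂ) * starRingEnd ℂ ((Pi.single k 1 : Fin n → ℂ) j) =
      (ε k : ℂ) * (Pi.single k 1 : Fin n → ℂ) j := by
    rcases eq_or_ne j k with rfl | hjk
    · simp
    · simp [hjk]
  constructor
  · rw [← real_mul_fderiv_eq_conj_of_eigenvector hHσ hHC (hH z) hfix (e := ε k),
      ← mul_assoc, hsq, one_mul]
    exact Prod.ext (funext hsingle) (by ext; simp [Ceps, sigmaConj])
  · rw [← real_mul_fderiv_eq_conj_of_eigenvector hHσ hHC (hH z) hfix (e := ε k),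
      ← mul_assoc, hsq, one_mul]
    exact Prod.ext (by ext; simp [Ceps, sigmaConj]) (funext hsingle)
end

section
/- Let n ≥ 1, ε : Fin n → ℝ with ε_k ∈ {+1, −1}, and let H : (Fin n → ℂ) × (Fin n → ℂ) → ℂ be holomorphic (differentiable over ℂ on all of the space) with H ∘ σ = conj ∘ H and H ∘ C_ε = H. Let p, q : ℝ → (Fin n → ℂ) be continuously differentiable curves solving the complexified Hamilton equations dp_k/dt = −∂H/∂q_k(p(t),q(t)), dq_k/dt = ∂H/∂p_k(p(t),q(t)) for all t ∈ ℝ. If the initial point (p(0), q(0)) is a fixed point of C̃_ε = C_ε ∘ σ (i.e. ε_k conj(p_k(0)) = p_k(0) and ε_k conj(q_k(0)) = q_k(0) for all k), then (p(t), q(t)) is a fixed point of C̃_ε for every t ∈ ℝ; i.e. the real form M_ℝ is invariant under the complexified Hamiltonian flow. -/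
open Metric in
/-- Cauchy estimate for the Fréchet derivative on the unit ball around a point. -/
lemma norm_fderiv_le_of_forall_mem_closedBall_norm_le {E F : Type*}
    [NormedAddCommGroup E] [NormedSpace ℂ E] [NormedAddCommGroup F] [NormedSpace ℂ F]
    {f : E → F} (hf : Differentiable ℂ f) {x : E} {M : ℝ}
    (hM : ∀ y ∈ closedBall x 1, ‖f y‖ ≤ M) : ‖fderiv ℂ f x‖ ≤ M := by
  have hM0 : 0 ≤ M := (norm_nonneg _).trans (hM x (mem_closedBall_self zero_le_one))
  refine ContinuousLinearMap.opNorm_le_of_unit_norm hM0 fun v hv => ?_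
  have hline : Differentiable ℂ fun ζ : ℂ => x + ζ • v := by fun_prop
  have hderiv : deriv (fun ζ : ℂ => f (x + ζ • v)) 0 = fderiv ℂ f x v :=
    (hf x).lineDeriv_eq_fderiv
  rw [← hderiv, ← div_one M]
  refine Complex.norm_deriv_le_of_forall_mem_sphere_norm_le one_pos
    (hf.comp hline).diffContOnCl fun ζ hζ => hM _ ?_
  rw [mem_sphere_zero_iff_norm] at hζ
  simp [norm_smul, hζ, hv]

open Metric in
/-- An entire function on a finite-dimensional space has a derivative that is Lipschitz on
bounded sets. -/
lemma Differentiable.exists_lipschitzOnWith_fderiv_closedBall {E F : Type*}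
    [NormedAddCommGroup E] [NormedSpace ℂ E] [ProperSpace E]
    [NormedAddCommGroup F] [NormedSpace ℂ F]
    {f : E → F} (hf : Differentiable ℂ f) (R : ℝ) :
    ∃ K, LipschitzOnWith K (fderiv ℂ f) (closedBall 0 R) := by
  let : NormedSpace ℝ E := NormedSpace.restrictScalars ℝ ℂ E
  obtain ⟨M, hM⟩ := (isCompact_closedBall (0 : E) (R + 2)).exists_bound_of_continuousOn
    hf.continuous.continuousOn
  have hfd : ∀ x ∈ closedBall (0 : E) (R + 1), ‖fderiv ℂ f x‖ ≤ M := fun x hx =>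
    norm_fderiv_le_of_forall_mem_closedBall_norm_le hf fun y hy => hM y <|
      closedBall_subset_closedBall' (by rw [mem_closedBall] at hx; linarith) hy
  have hM' : M ≤ (M.toNNReal : ℝ) := Real.le_coe_toNNReal M
  refine ⟨M.toNNReal, LipschitzOnWith.of_dist_le_mul fun x hx y hy => ?_⟩
  have hshift : Differentiable ℂ fun w => f (w + (x - y)) :=
    hf.comp (differentiable_id.add_const _)
  have hsub : fderiv ℂ (fun w => f (w + (x - y)) - f w) y = fderiv ℂ f x - fderiv ℂ f y := by
    rw [fderiv_fun_sub (hshift y) (hf y), fderiv_comp_add_right, add_sub_cancel]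
  rw [dist_eq_norm, dist_eq_norm, ← hsub]
  refine norm_fderiv_le_of_forall_mem_closedBall_norm_le (hshift.sub hf) fun w hw => ?_
  rw [mem_closedBall_zero_iff] at hx hy
  rw [mem_closedBall, dist_eq_norm] at hw
  have hw₁ : w ∈ closedBall (0 : E) (R + 1) := by
    rw [mem_closedBall_zero_iff]
    linarith [norm_le_norm_add_norm_sub' w y]
  have hw₂ : w + (x - y) ∈ closedBall (0 : E) (R + 1) := by
    rw [mem_closedBall_zero_iff, show w + (x - y) = x + (w - y) by abel]
    linarith [norm_add_le x (w - y)]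
  have := (convex_closedBall (0 : E) (R + 1)).norm_image_sub_le_of_norm_fderiv_le (𝕜 := ℂ)
    (fun z _ => hf z) (fun z hz => (hfd z hz).trans hM') hw₁ hw₂
  simpa using this

/-- An autonomous ODE whose vector field is Lipschitz on bounded sets has at most one global
solution through each point. -/
lemma ODE_solution_unique_of_lipschitzOnWith_closedBall {E : Type*}
    [NormedAddCommGroup E] [NormedSpace ℝ E] {v : E → E}
    (hv : ∀ R, ∃ K, LipschitzOnWith K v (Metric.closedBall 0 R)) {f g : ℝ → E} {t₀ : ℝ}
    (hf : ∀ t, HasDerivAt f (v (f t)) t) (hg : ∀ t, HasDerivAt g (v (g t)) t)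
    (heq : f t₀ = g t₀) : f = g := by
  ext t
  obtain ⟨a, b, ht, ht₀⟩ : ∃ a b, t ∈ Set.Ioo a b ∧ t₀ ∈ Set.Ioo a b :=
    ⟨min t t₀ - 1, max t t₀ + 1, by grind, by grind⟩
  have hfc : Continuous f := continuous_iff_continuousAt.2 fun t => (hf t).continuousAt
  have hgc : Continuous g := continuous_iff_continuousAt.2 fun t => (hg t).continuousAt
  obtain ⟨A, hA⟩ := isCompact_Icc.exists_bound_of_continuousOn (s := Set.Icc a b) hfc.continuousOn
  obtain ⟨B, hB⟩ := isCompact_Icc.exists_bound_of_continuousOn (s := Set.Icc a b) hgc.continuousOn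
  obtain ⟨K, hK⟩ := hv (max A B)
  refine ODE_solution_unique_of_mem_Ioo (v := fun _ => v)
    (s := fun _ => Metric.closedBall 0 (max A B)) (fun _ _ => hK) ht₀
    (fun s hs => ⟨hf s, ?_⟩) (fun s hs => ⟨hg s, ?_⟩) heq ht
  · exact mem_closedBall_zero_iff.2 ((hA s (Set.Ioo_subset_Icc_self hs)).trans (le_max_left _ _))
  · exact mem_closedBall_zero_iff.2 ((hB s (Set.Ioo_subset_Icc_self hs)).trans (le_max_right _ _))

/-- The Hamiltonian vector field `(-∂H/∂q, ∂H/∂p)`. -/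
noncomputable def hamiltonianField (n : ℕ) (H : (Fin n → ℂ) × (Fin n → ℂ) → ℂ)
    (z : (Fin n → ℂ) × (Fin n → ℂ)) : (Fin n → ℂ) × (Fin n → ℂ) :=
  (fun k => -(fderiv ℂ H z (0, Pi.single k 1)), fun k => fderiv ℂ H z (Pi.single k 1, 0))

lemma exists_lipschitzOnWith_hamiltonianField {n : ℕ} {H : (Fin n → ℂ) × (Fin n → ℂ) → ℂ}
    (hH : Differentiable ℂ H) (R : ℝ) :
    ∃ K, LipschitzOnWith K (hamiltonianField n H) (Metric.closedBall 0 R) := by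
  obtain ⟨K, hK⟩ := hH.exists_lipschitzOnWith_fderiv_closedBall R
  refine ⟨K, LipschitzOnWith.of_dist_le_mul fun x hx y hy => ?_⟩
  have happly : ∀ v : (Fin n → ℂ) × (Fin n → ℂ), ‖v‖ ≤ 1 →
      dist (fderiv ℂ H x v) (fderiv ℂ H y v) ≤ K * dist x y := fun v hv => by
    rw [dist_eq_norm, ← sub_apply]
    refine (ContinuousLinearMap.unit_le_opNorm _ v hv).trans ?_
    rw [← dist_eq_norm]
    exact hK.dist_le_mul x hx y hy
  have hpos : 0 ≤ K * dist x y := by positivity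
  refine max_le ((dist_pi_le_iff hpos).2 fun k => ?_) ((dist_pi_le_iff hpos).2 fun k => ?_)
  · simpa only [hamiltonianField, dist_neg_neg] using
      happly (0, Pi.single k 1) (by simp [Prod.norm_def, Pi.norm_single])
  · exact happly (Pi.single k 1, 0) (by simp [Prod.norm_def, Pi.norm_single])

lemma fderiv_Ceps_sigmaConj {n : ℕ} {ε : Fin n → ℝ} {H : (Fin n → ℂ) × (Fin n → ℂ) → ℂ}
    (hH : Differentiable ℂ H) (hHσ : ∀ z, H (sigmaConj n z) = starRingEnd ℂ (H z))
    (hHC : ∀ z, H (Ceps n ε z) = H z) (z v : (Fin n → ℂ) × (Fin n → ℂ)) :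
    fderiv ℂ H (Ceps n ε (sigmaConj n z)) (Ceps n ε (sigmaConj n v)) =
      starRingEnd ℂ (fderiv ℂ H z v) := by
  have hg : HasDerivAt (fun ζ : ℂ => H (z + ζ • v)) (fderiv ℂ H z v) 0 :=
    (hH z).hasFDerivAt.hasLineDerivAt v
  have hconj := hg.conj_conj
  rw [map_zero] at hconj
  have hT : HasDerivAt
      (fun ζ : ℂ => H (Ceps n ε (sigmaConj n z) + ζ • Ceps n ε (sigmaConj n v)))
      (fderiv ℂ H (Ceps n ε (sigmaConj n z)) (Ceps n ε (sigmaConj n v))) 0 :=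
    (hH _).hasFDerivAt.hasLineDerivAt _
  refine hT.unique (hconj.congr_of_eventuallyEq (.of_forall fun ζ => ?_))
  have hlin : Ceps n ε (sigmaConj n z) + ζ • Ceps n ε (sigmaConj n v) =
      Ceps n ε (sigmaConj n (z + starRingEnd ℂ ζ • v)) := by
    ext k <;> simp [Ceps, sigmaConj] <;> ring
  simp only [hlin, hHC, hHσ, Function.comp_apply]

lemma hamiltonianField_Ceps_sigmaConj {n : ℕ} {ε : Fin n → ℝ}
    (hε : ∀ k, ε k = 1 ∨ ε k = -1) {H : (Fin n → ℂ) × (Fin n → ℂ) → ℂ}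
    (hH : Differentiable ℂ H) (hHσ : ∀ z, H (sigmaConj n z) = starRingEnd ℂ (H z))
    (hHC : ∀ z, H (Ceps n ε z) = H z) (z : (Fin n → ℂ) × (Fin n → ℂ)) :
    hamiltonianField n H (Ceps n ε (sigmaConj n z)) =
      Ceps n ε (sigmaConj n (hamiltonianField n H z)) := by
  have hdir : ∀ (k : Fin n) (v : (Fin n → ℂ) × (Fin n → ℂ)),
      Ceps n ε (sigmaConj n v) = (ε k : ℂ) • v →
      fderiv ℂ H (Ceps n ε (sigmaConj n z)) v = ε k * starRingEnd ℂ (fderiv ℂ H z v) := by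
    intro k v hv
    have h := fderiv_Ceps_sigmaConj hH hHσ hHC z v
    rw [hv, map_smul, smul_eq_mul] at h
    rw [← h, ← mul_assoc, ← Complex.ofReal_mul]
    rcases hε k with h | h <;> simp [h]
  have hsingle : ∀ k j : Fin n, (ε j : ℂ) * starRingEnd ℂ ((Pi.single k 1 : Fin n → ℂ) j) =
      ε k * (Pi.single k 1 : Fin n → ℂ) j := by
    intro k j
    by_cases h : j = k
    · subst h; simp
    · simp [h]
  ext k
  · have := hdir k (0, Pi.single k 1) (by ext j <;> simp [Ceps, sigmaConj, hsingle])
    simpa [hamiltonianField, Ceps, sigmaConj] using this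
  · have := hdir k (Pi.single k 1, 0) (by ext j <;> simp [Ceps, sigmaConj, hsingle])
    simpa [hamiltonianField, Ceps, sigmaConj] using this

lemma HasDerivAt.Ceps_sigmaConj {n : ℕ} (ε : Fin n → ℝ)
    {f : ℝ → (Fin n → ℂ) × (Fin n → ℂ)} {f' : (Fin n → ℂ) × (Fin n → ℂ)} {t : ℝ}
    (hf : HasDerivAt f f' t) :
    HasDerivAt (fun s => Ceps n ε (sigmaConj n (f s))) (Ceps n ε (sigmaConj n f')) t :=
  (hasDerivAt_pi.2 fun k => ((hasDerivAt_pi.1 hf.fst k).star).const_mul (ε k : ℂ)).prodMk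
    (hasDerivAt_pi.2 fun k => ((hasDerivAt_pi.1 hf.snd k).star).const_mul (ε k : ℂ))

/-- Invariance of the real form `M_ℝ` (the fixed point set of `C̃_ε = C_ε ∘ σ`)
under the complexified Hamiltonian flow: if continuously differentiable curves
`p, q` solve the complexified Hamilton equations for a holomorphic `H` with
`H ∘ σ = conj ∘ H` and `H ∘ C_ε = H`, and `(p 0, q 0)` is a fixed point of `C̃_ε`,
then `(p t, q t)` is a fixed point of `C̃_ε` for all `t`. -/
theorem real_form_invariant_under_flow
    (n : ℕ) (hn : 1 ≤ n) (ε : Fin n → ℝ) (hε : ∀ k, ε k = 1 ∨ ε k = -1)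
    (H : (Fin n → ℂ) × (Fin n → ℂ) → ℂ) (hH : Differentiable ℂ H)
    (hHσ : ∀ z, H (sigmaConj n z) = starRingEnd ℂ (H z))
    (hHC : ∀ z, H (Ceps n ε z) = H z)
    (p q : ℝ → Fin n → ℂ) (hp : ContDiff ℝ 1 p) (hq : ContDiff ℝ 1 q)
    (hameqp : ∀ t k, deriv (fun s => p s k) t
      = -(fderiv ℂ H (p t, q t) (0, Pi.single k 1)))
    (hameqq : ∀ t k, deriv (fun s => q s k) t
      = fderiv ℂ H (p t, q t) (Pi.single k 1, 0))
    (h0 : ∀ k, (ε k : ℂ) * starRingEnd ℂ (p 0 k) = p 0 k ∧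
      (ε k : ℂ) * starRingEnd ℂ (q 0 k) = q 0 k) :
    ∀ t k, (ε k : ℂ) * starRingEnd ℂ (p t k) = p t k ∧
      (ε k : ℂ) * starRingEnd ℂ (q t k) = q t k := by
  have hz : ∀ t, HasDerivAt (fun s => (p s, q s)) (hamiltonianField n H (p t, q t)) t := by
    intro t
    have hpt := hasDerivAt_pi.1 (hp.differentiable one_ne_zero t).hasDerivAt
    have hqt := hasDerivAt_pi.1 (hq.differentiable one_ne_zero t).hasDerivAt
    refine (hasDerivAt_pi.2 fun k => ?_).prodMk (hasDerivAt_pi.2 fun k => ?_)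
    · rw [← hameqp]
      exact (hpt k).differentiableAt.hasDerivAt
    · rw [← hameqq]
      exact (hqt k).differentiableAt.hasDerivAt
  have hTz : ∀ t, HasDerivAt (fun s => Ceps n ε (sigmaConj n (p s, q s)))
      (hamiltonianField n H (Ceps n ε (sigmaConj n (p t, q t)))) t := by
    intro t
    rw [hamiltonianField_Ceps_sigmaConj hε hH hHσ hHC]
    exact (hz t).Ceps_sigmaConj ε
  have heq := ODE_solution_unique_of_lipschitzOnWith_closedBall
    (exists_lipschitzOnWith_hamiltonianField hH) hTz hz (t₀ := 0)
    (Prod.ext (funext fun k => (h0 k).1) (funext fun k => (h0 k).2))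
  intro t k
  have ht := congrFun heq t
  exact ⟨congrFun (congrArg Prod.fst ht) k, congrFun (congrArg Prod.snd ht) k⟩
end

section
/- Let n ≥ 1, let H : (Fin n → ℂ) × (Fin n → ℂ) → ℂ be holomorphic, and write H_0 = Re H. Let p, q : ℝ → (Fin n → ℂ) be differentiable curves and write p_k(t) = p_{k,0}(t) + i p_{k,1}(t), q_k(t) = q_{k,0}(t) + i q_{k,1}(t). Then at any time t the complexified Hamilton equations dp_k/dt = −∂H/∂q_k, dq_k/dt = ∂H/∂p_k (with complex directional derivatives) hold for all k if and only if the real Hamiltonian equations for (H_0, ω_0) hold for all k: dp_{k,0}/dt = −∂H_0/∂q_{k,0}, dp_{k,1}/dt = +∂H_0/∂q_{k,1}, dq_{k,0}/dt = ∂H_0/∂p_{k,0}, dq_{k,1}/dt = −∂H_0/∂p_{k,1}. -/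
theorem HasDerivAt.complex_re {f : ℝ → ℂ} {f' : ℂ} {t : ℝ} (hf : HasDerivAt f f' t) :
    HasDerivAt (fun s => (f s).re) f'.re t :=
  Complex.reCLM.hasFDerivAt.comp_hasDerivAt t hf

theorem HasDerivAt.complex_im {f : ℝ → ℂ} {f' : ℂ} {t : ℝ} (hf : HasDerivAt f f' t) :
    HasDerivAt (fun s => (f s).im) f'.im t :=
  Complex.imCLM.hasFDerivAt.comp_hasDerivAt t hf

theorem fderiv_re_apply {E : Type*} [NormedAddCommGroup E] [NormedSpace ℂ E] {H : E → ℂ} {x : E}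
    (hH : DifferentiableAt ℂ H x) (v : E) :
    fderiv ℝ (fun z => (H z).re) x v = (fderiv ℂ H x v).re := by
  have h : HasFDerivAt (fun z => (H z).re)
      (Complex.reCLM ∘L (fderiv ℂ H x).restrictScalars ℝ) x :=
    Complex.reCLM.hasFDerivAt.comp x (hH.hasFDerivAt.restrictScalars ℝ)
  rw [h.fderiv]
  rfl

theorem fderiv_re_I_smul {E : Type*} [NormedAddCommGroup E] [NormedSpace ℂ E] {H : E → ℂ} {x : E}
    (hH : DifferentiableAt ℂ H x) (v : E) :
    fderiv ℝ (fun z => (H z).re) x (Complex.I • v) = -(fderiv ℂ H x v).im := by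
  simp [fderiv_re_apply hH]

/-- Equivalence between the complexified Hamilton equations for a holomorphic `H`
(with complex directional derivatives) and the real Hamilton equations of
`H₀ = Re H` with respect to the real symplectic form
`ω₀ = Re ω^ℂ = Σ (dp_{k,0} ∧ dq_{k,0} − dp_{k,1} ∧ dq_{k,1})`. Here
`p_{k,0} = Re p_k`, `p_{k,1} = Im p_k` (similarly for `q`), and the real
directional derivatives of `H₀` along `e_k` and `i·e_k` encode
`∂H₀/∂p_{k,0}`, `∂H₀/∂p_{k,1}`, `∂H₀/∂q_{k,0}`, `∂H₀/∂q_{k,1}`. -/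
theorem complex_hamilton_iff_real_hamilton
    (n : ℕ) (hn : 1 ≤ n) (H : (Fin n → ℂ) × (Fin n → ℂ) → ℂ)
    (hH : Differentiable ℂ H)
    (p q : ℝ → Fin n → ℂ)
    (hp : ∀ k, Differentiable ℝ (fun t => p t k))
    (hq : ∀ k, Differentiable ℝ (fun t => q t k))
    (t : ℝ) :
    ((∀ k, deriv (fun s => p s k) t
        = -(fderiv ℂ H (p t, q t) (0, Pi.single k 1)) ∧
      deriv (fun s => q s k) t
        = fderiv ℂ H (p t, q t) (Pi.single k 1, 0))
      ↔
    (∀ k, deriv (fun s => (p s k).re) t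
        = -(fderiv ℝ (fun z => (H z).re) (p t, q t) (0, Pi.single k 1)) ∧
      deriv (fun s => (p s k).im) t
        = fderiv ℝ (fun z => (H z).re) (p t, q t) (0, Pi.single k Complex.I) ∧
      deriv (fun s => (q s k).re) t
        = fderiv ℝ (fun z => (H z).re) (p t, q t) (Pi.single k 1, 0) ∧
      deriv (fun s => (q s k).im) t
        = -(fderiv ℝ (fun z => (H z).re) (p t, q t) (Pi.single k Complex.I, 0)))) := by
  refine forall_congr' fun k => ?_
  have hx : DifferentiableAt ℂ H (p t, q t) := hH _
  have hsingle : Pi.single k Complex.I = Complex.I • (Pi.single k 1 : Fin n → ℂ) := by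
    rw [← Pi.single_smul, smul_eq_mul, mul_one]
  have hqI : ((0, Pi.single k Complex.I) : (Fin n → ℂ) × (Fin n → ℂ))
      = Complex.I • (0, Pi.single k 1) := by
    rw [Prod.smul_mk, smul_zero, hsingle]
  have hpI : ((Pi.single k Complex.I, 0) : (Fin n → ℂ) × (Fin n → ℂ))
      = Complex.I • (Pi.single k 1, 0) := by
    rw [Prod.smul_mk, smul_zero, hsingle]
  rw [hqI, hpI, fderiv_re_I_smul hx, fderiv_re_I_smul hx, fderiv_re_apply hx, fderiv_re_apply hx,
    (hp k t).hasDerivAt.complex_re.deriv, (hp k t).hasDerivAt.complex_im.deriv,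
    (hq k t).hasDerivAt.complex_re.deriv, (hq k t).hasDerivAt.complex_im.deriv,
    Complex.ext_iff, Complex.ext_iff, Complex.neg_re, Complex.neg_im, neg_neg, and_assoc]
end

section
/- Let a, b ≥ 1 and let f : (Fin a → ℝ) × (Fin b → ℝ) → ℝ be differentiable. Assume that for every y, y' and every x the derivative of the partial map x ↦ f(x,y) at x equals the derivative of x ↦ f(x,y') at x (i.e. all mixed second partial derivatives of f between the x-block and the y-block vanish). Then there exist functions g : (Fin a → ℝ) → ℝ and h : (Fin b → ℝ) → ℝ such that f(x,y) = g(x) + h(y) for all (x,y); i.e. f is separable into a sum of a function of x and a function of y. -/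
/-- If all mixed second partial derivatives of a differentiable function
`f : (Fin a → ℝ) × (Fin b → ℝ) → ℝ` between the `x`-block and the `y`-block vanish
(i.e. the partial derivative in `x` does not depend on `y`), then `f` is separable:
`f (x, y) = g x + h y`. -/
theorem separable_of_mixed_partials_vanish
    (a b : ℕ) (ha : 1 ≤ a) (hb : 1 ≤ b)
    (f : (Fin a → ℝ) × (Fin b → ℝ) → ℝ) (hf : Differentiable ℝ f)
    (hmix : ∀ (x : Fin a → ℝ) (y y' : Fin b → ℝ),
      fderiv ℝ (fun x' => f (x', y)) x = fderiv ℝ (fun x' => f (x', y')) x) :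
    ∃ (g : (Fin a → ℝ) → ℝ) (h : (Fin b → ℝ) → ℝ),
      ∀ x y, f (x, y) = g x + h y := by
  have hpartial (y : Fin b → ℝ) : Differentiable ℝ fun x' => f (x', y) := by fun_prop
  refine ⟨fun x => f (x, 0), fun y => f (0, y) - f (0, 0), fun x y => ?_⟩
  have hconst := is_const_of_fderiv_eq_zero ((hpartial y).sub (hpartial 0)) (fun z => by
    rw [fderiv_sub (hpartial y z) (hpartial 0 z), hmix z y 0, sub_self]) x 0
  simp only [Pi.sub_apply] at hconst
  linarith
end

section
/- Let a, b ≥ 1. Let Hℂ : ((Fin a → ℂ) × (Fin a → ℂ)) × ((Fin b → ℂ) × (Fin b → ℂ)) → ℂ be holomorphic, satisfying Hℂ ∘ σ = conj ∘ Hℂ (where σ is componentwise complex conjugation) and Hℂ(u⁺, −u⁻) = Hℂ(u⁺, u⁻) for all u⁺, u⁻ (invariance under the involution which is +1 on the first block and −1 on the second). Let H be the restriction of Hℂ to real points (so H is real-valued), and define the real Hamiltonian form H_R on real points by H_R(x⁺, x⁻) = Re Hℂ(x⁺, i·x⁻). Then the following are equivalent: (1) at every real point, for all k and j, ∂H/∂p⁺_k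 = ∂H_R/∂p⁺_k, ∂H/∂q⁺_k = ∂H_R/∂q⁺_k, ∂H/∂p⁻_j = −∂H_R/∂p⁻_j, and ∂H/∂q⁻_j = −∂H_R/∂q⁻_j (i.e. the real-form dynamical vector field Γ_R coincides with the initial dynamical vector field Γ); (2) there exist g : (Fin a → ℝ) × (Fin a → ℝ) → ℝ and h : (Fin b → ℝ) × (Fin b → ℝ) → ℝ such that H(x⁺, x⁻) = g(x⁺) + h(x⁻) and H_R(x⁺, x⁻) = g(x⁺) − h(x⁻) for all real points (x⁺, x⁻). -/
/-- Componentwise complex conjugation on the doubled phase space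
`((p⁺,q⁺),(p⁻,q⁻))`. -/
def sigmaConj2 (a b : ℕ)
    (z : ((Fin a → ℂ) × (Fin a → ℂ)) × ((Fin b → ℂ) × (Fin b → ℂ))) :
    ((Fin a → ℂ) × (Fin a → ℂ)) × ((Fin b → ℂ) × (Fin b → ℂ)) :=
  ((fun k => starRingEnd ℂ (z.1.1 k), fun k => starRingEnd ℂ (z.1.2 k)),
    (fun j => starRingEnd ℂ (z.2.1 j), fun j => starRingEnd ℂ (z.2.2 j)))

/-- Embedding of the real points into the complex phase space. -/
def realEmb (a b : ℕ)
    (x : ((Fin a → ℝ) × (Fin a → ℝ)) × ((Fin b → ℝ) × (Fin b → ℝ))) :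
    ((Fin a → ℂ) × (Fin a → ℂ)) × ((Fin b → ℂ) × (Fin b → ℂ)) :=
  ((fun k => (x.1.1 k : ℂ), fun k => (x.1.2 k : ℂ)),
    (fun j => (x.2.1 j : ℂ), fun j => (x.2.2 j : ℂ)))

/-- Embedding of the real points with the second block multiplied by `i`
(parametrizing the real form `M_ℝ`). -/
def realFormEmb (a b : ℕ)
    (x : ((Fin a → ℝ) × (Fin a → ℝ)) × ((Fin b → ℝ) × (Fin b → ℝ))) :
    ((Fin a → ℂ) × (Fin a → ℂ)) × ((Fin b → ℂ) × (Fin b → ℂ)) :=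
  ((fun k => (x.1.1 k : ℂ), fun k => (x.1.2 k : ℂ)),
    (fun j => Complex.I * (x.2.1 j : ℂ), fun j => Complex.I * (x.2.2 j : ℂ)))

theorem ContinuousLinearMap.eq_zero_of_pi_prod_single {m n : ℕ}
    (L : ((Fin m → ℝ) × (Fin n → ℝ)) →L[ℝ] ℝ)
    (hp : ∀ k, L (Pi.single k 1, 0) = 0) (hq : ∀ k, L (0, Pi.single k 1) = 0) : L = 0 := by
  apply ContinuousLinearMap.coe_injective
  apply LinearMap.prod_ext <;> refine LinearMap.pi_ext' fun k => LinearMap.ext_ring ?_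
  · simpa using hp k
  · simpa using hq k

/-- A differentiable function whose partial derivative in the second variable vanishes does not
depend on that variable. -/
theorem Differentiable.eq_of_fderiv_comp_inr_eq_zero {E F : Type*} [NormedAddCommGroup E]
    [NormedSpace ℝ E] [NormedAddCommGroup F] [NormedSpace ℝ F] {f : E × F → ℝ}
    (hf : Differentiable ℝ f)
    (h : ∀ x, (fderiv ℝ f x).comp (ContinuousLinearMap.inr ℝ E F) = 0) (u : E) (v w : F) :
    f (u, v) = f (u, w) := by
  have hd (y : F) : HasFDerivAt (fun y => f (u, y)) (0 : F →L[ℝ] ℝ) y := by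
    rw [← h (u, y)]
    exact (hf (u, y)).hasFDerivAt.comp y (hasFDerivAt_prodMk_right u y)
  exact is_const_of_fderiv_eq_zero (fun y => (hd y).differentiableAt) (fun y => (hd y).fderiv) v w

/-- A differentiable function whose partial derivative in the first variable vanishes does not
depend on that variable. -/
theorem Differentiable.eq_of_fderiv_comp_inl_eq_zero {E F : Type*} [NormedAddCommGroup E]
    [NormedSpace ℝ E] [NormedAddCommGroup F] [NormedSpace ℝ F] {f : E × F → ℝ}
    (hf : Differentiable ℝ f)
    (h : ∀ x, (fderiv ℝ f x).comp (ContinuousLinearMap.inl ℝ E F) = 0) (u v : E) (w : F) :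
    f (u, w) = f (v, w) := by
  have hd (y : E) : HasFDerivAt (fun y => f (y, w)) (0 : E →L[ℝ] ℝ) y := by
    rw [← h (y, w)]
    exact (hf (y, w)).hasFDerivAt.comp y (hasFDerivAt_prodMk_left y w)
  exact is_const_of_fderiv_eq_zero (fun y => (hd y).differentiableAt) (fun y => (hd y).fderiv) u v

theorem fderiv_apply_inr_eq_zero {E F : Type*} [NormedAddCommGroup E] [NormedSpace ℝ E]
    [NormedAddCommGroup F] [NormedSpace ℝ F] {f : E × F → ℝ} {g : E → ℝ} {x : E × F}
    (hf : DifferentiableAt ℝ f x) (hfg : ∀ y, f y = g y.1) (v : F) :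
    fderiv ℝ f x (0, v) = 0 := by
  have h := HasFDerivAt.comp (g := f) (f := fun y => (x.1, y)) x.2 hf.hasFDerivAt
    (hasFDerivAt_prodMk_right x.1 x.2)
  have hc : f ∘ (fun y => (x.1, y)) = fun _ => g x.1 := funext fun y => hfg _
  rw [hc] at h
  simpa using DFunLike.congr_fun (h.unique (hasFDerivAt_const (g x.1) x.2)) v

theorem fderiv_apply_inl_eq_zero {E F : Type*} [NormedAddCommGroup E] [NormedSpace ℝ E]
    [NormedAddCommGroup F] [NormedSpace ℝ F] {f : E × F → ℝ} {g : F → ℝ} {x : E × F}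
    (hf : DifferentiableAt ℝ f x) (hfg : ∀ y, f y = g y.2) (v : E) :
    fderiv ℝ f x (v, 0) = 0 := by
  have h := HasFDerivAt.comp (g := f) (f := fun y => (y, x.2)) x.1 hf.hasFDerivAt
    (hasFDerivAt_prodMk_left x.1 x.2)
  have hc : f ∘ (fun y => (y, x.2)) = fun _ => g x.2 := funext fun y => hfg _
  rw [hc] at h
  simpa using DFunLike.congr_fun (h.unique (hasFDerivAt_const (g x.2) x.1)) v

theorem differentiable_realEmb (a b : ℕ) : Differentiable ℝ (realEmb a b) := by
  have h : Differentiable ℝ (fun t : ℝ => (t : ℂ)) := Complex.ofRealCLM.differentiable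
  unfold realEmb
  fun_prop

theorem differentiable_realFormEmb (a b : ℕ) : Differentiable ℝ (realFormEmb a b) := by
  have h : Differentiable ℝ (fun t : ℝ => (t : ℂ)) := Complex.ofRealCLM.differentiable
  unfold realFormEmb
  fun_prop

/-- Proposition 3 of Gerdjikov–Kyuldjiev–Marmo–Vilasi: for a holomorphic `Hℂ`
which is real (`Hℂ ∘ σ = conj ∘ Hℂ`) and invariant under the involution which is
`+1` on the first block and `−1` on the second, the real-form dynamical vector
field `Γ_R` coincides with the initial one `Γ` (expressed by the four gradient
identities relating `H` and `H_R` at every real point) if and only if `H` and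
`H_R` separate as `H = g + h` and `H_R = g − h`. -/
theorem gammaR_eq_gamma_iff_separable
    (a b : ℕ) (ha : 1 ≤ a) (hb : 1 ≤ b)
    (Hc : ((Fin a → ℂ) × (Fin a → ℂ)) × ((Fin b → ℂ) × (Fin b → ℂ)) → ℂ)
    (hHol : Differentiable ℂ Hc)
    (hσ : ∀ z, Hc (sigmaConj2 a b z) = starRingEnd ℂ (Hc z))
    (hpar : ∀ (u : (Fin a → ℂ) × (Fin a → ℂ)) (v : (Fin b → ℂ) × (Fin b → ℂ)),
      Hc (u, -v) = Hc (u, v))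
    (H HR : ((Fin a → ℝ) × (Fin a → ℝ)) × ((Fin b → ℝ) × (Fin b → ℝ)) → ℝ)
    (hHdef : ∀ x, H x = (Hc (realEmb a b x)).re)
    (hHRdef : ∀ x, HR x = (Hc (realFormEmb a b x)).re) :
    ((∀ x, (∀ k : Fin a,
        fderiv ℝ H x ((Pi.single k 1, 0), (0, 0))
          = fderiv ℝ HR x ((Pi.single k 1, 0), (0, 0)) ∧
        fderiv ℝ H x ((0, Pi.single k 1), (0, 0))
          = fderiv ℝ HR x ((0, Pi.single k 1), (0, 0))) ∧
      (∀ j : Fin b,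
        fderiv ℝ H x ((0, 0), (Pi.single j 1, 0))
          = -fderiv ℝ HR x ((0, 0), (Pi.single j 1, 0)) ∧
        fderiv ℝ H x ((0, 0), (0, Pi.single j 1))
          = -fderiv ℝ HR x ((0, 0), (0, Pi.single j 1))))
    ↔
    (∃ (g : (Fin a → ℝ) × (Fin a → ℝ) → ℝ) (h : (Fin b → ℝ) × (Fin b → ℝ) → ℝ),
      ∀ x, H x = g x.1 + h x.2 ∧ HR x = g x.1 - h x.2)) := by
  have hHol' : Differentiable ℝ Hc := hHol.restrictScalars ℝ
  have hH : Differentiable ℝ H := by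
    rw [funext hHdef]
    exact Complex.reCLM.differentiable.comp (hHol'.comp (differentiable_realEmb a b))
  have hHR : Differentiable ℝ HR := by
    rw [funext hHRdef]
    exact Complex.reCLM.differentiable.comp (hHol'.comp (differentiable_realFormEmb a b))
  have hadd (x v) : fderiv ℝ (H + HR) x v = fderiv ℝ H x v + fderiv ℝ HR x v := by
    rw [fderiv_add (hH x) (hHR x)]; rfl
  have hsub (x v) : fderiv ℝ (H - HR) x v = fderiv ℝ H x v - fderiv ℝ HR x v := by
    rw [fderiv_sub (hH x) (hHR x)]; rfl
  constructor
  · intro hgrad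
    have hplus := (hH.add hHR).eq_of_fderiv_comp_inr_eq_zero fun x =>
      ContinuousLinearMap.eq_zero_of_pi_prod_single _
        (fun j => (hadd x _).trans (add_eq_zero_iff_eq_neg.2 ((hgrad x).2 j).1))
        (fun j => (hadd x _).trans (add_eq_zero_iff_eq_neg.2 ((hgrad x).2 j).2))
    have hminus := (hH.sub hHR).eq_of_fderiv_comp_inl_eq_zero fun x =>
      ContinuousLinearMap.eq_zero_of_pi_prod_single _
        (fun k => (hsub x _).trans (sub_eq_zero.2 ((hgrad x).1 k).1))
        (fun k => (hsub x _).trans (sub_eq_zero.2 ((hgrad x).1 k).2))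
    refine ⟨fun u => (H + HR) (u, 0) / 2, fun v => (H - HR) (0, v) / 2, fun x => ?_⟩
    dsimp only
    rw [hplus x.1 0 x.2, hminus 0 x.1 x.2]
    simp only [Pi.add_apply, Pi.sub_apply, Prod.mk.eta]
    constructor <;> ring
  · rintro ⟨g, h, hgh⟩ x
    have hplus (v) : fderiv ℝ H x (0, v) = -fderiv ℝ HR x (0, v) := by
      rw [← add_eq_zero_iff_eq_neg, ← hadd]
      refine fderiv_apply_inr_eq_zero (g := fun u => 2 * g u) ((hH.add hHR) x) (fun y => ?_) v
      rw [Pi.add_apply, (hgh y).1, (hgh y).2]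
      ring
    have hminus (u) : fderiv ℝ H x (u, 0) = fderiv ℝ HR x (u, 0) := by
      rw [← sub_eq_zero, ← hsub]
      refine fderiv_apply_inl_eq_zero (g := fun v => 2 * h v) ((hH.sub hHR) x) (fun y => ?_) u
      rw [Pi.sub_apply, (hgh y).1, (hgh y).2]
      ring
    exact ⟨fun k => ⟨hminus _, hminus _⟩, fun j => ⟨hplus _, hplus _⟩⟩
end

section
/- Let n ≥ 1, ε : Fin n → ℝ with ε_k ∈ {+1, −1}, and define the embedding ι_ε : (Fin n → ℝ) × (Fin n → ℝ) → (Fin n → ℂ) × (Fin n → ℂ) by (ι_ε(x,y))_k = (x_k, y_k) if ε_k = +1 and (i·x_k, i·y_k) if ε_k = −1 (a parametrization of the real form M_ℝ). Let F, G : (Fin n → ℂ) × (Fin n → ℂ) → ℂ be holomorphic, each invariant under the antiholomorphic involution C̃_ε in the sense that conj(F(C_ε(σ(z)))) = F(z) and conj(G(C_ε(σ(z)))) = G(z) for all z, and suppose {F, G}_ℂ = 0 identically. Then the real-valued functions F_ℝ = Re(F ∘ ι_ε) and G_ℝ = Re(G ∘ ι_ε) on (Fin n → ℝ) × (Fin n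 → ℝ) satisfy {F_ℝ, G_ℝ}_ε = 0 identically, where {A, B}_ε = Σ_{k=1}^n ε_k (∂A/∂x_k ∂B/∂y_k − ∂A/∂y_k ∂B/∂x_k) is the Poisson bracket of the symplectic form ω_ℝ = Σ_k ε_k dx_k ∧ dy_k. (Thus the real Hamiltonian form of a Liouville integrable system is Liouville integrable.) -/
/-- The parametrization `ι_ε` of the real form `M_ℝ`: the `k`-th coordinates are
real when `ε_k = +1` and purely imaginary when `ε_k = −1`. -/
noncomputable def iotaEps (n : ℕ) (ε : Fin n → ℝ)
    (w : (Fin n → ℝ) × (Fin n → ℝ)) : (Fin n → ℂ) × (Fin n → ℂ) :=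
  (fun k => if ε k = 1 then (w.1 k : ℂ) else Complex.I * (w.1 k : ℂ),
    fun k => if ε k = 1 then (w.2 k : ℂ) else Complex.I * (w.2 k : ℂ))

/-- The real Poisson bracket `{A,B}_ε = Σ ε_k (∂A/∂x_k ∂B/∂y_k − ∂A/∂y_k ∂B/∂x_k)`
of the restricted symplectic form `ω_ℝ = Σ ε_k dx_k ∧ dy_k`. -/
noncomputable def realPBeps (n : ℕ) (ε : Fin n → ℝ)
    (A B : (Fin n → ℝ) × (Fin n → ℝ) → ℝ) (w : (Fin n → ℝ) × (Fin n → ℝ)) : ℝ :=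
  ∑ k : Fin n, ε k *
    (fderiv ℝ A w (Pi.single k 1, 0) * fderiv ℝ B w (0, Pi.single k 1)
      - fderiv ℝ A w (0, Pi.single k 1) * fderiv ℝ B w (Pi.single k 1, 0))

/-- The coefficient by which `ι_ε` scales the `k`-th coordinates: `1` or `i`. -/
noncomputable def iotaCoeff (n : ℕ) (ε : Fin n → ℝ) (k : Fin n) : ℂ :=
  if ε k = 1 then 1 else Complex.I

lemma iotaCoeff_mul_self {n : ℕ} {ε : Fin n → ℝ} (hε : ∀ k, ε k = 1 ∨ ε k = -1) (k : Fin n) :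
    (ε k : ℂ) * (iotaCoeff n ε k * iotaCoeff n ε k) = 1 := by
  rcases hε k with h | h <;> norm_num [iotaCoeff, h]

lemma iotaEps_eq (n : ℕ) (ε : Fin n → ℝ) (w : (Fin n → ℝ) × (Fin n → ℝ)) :
    iotaEps n ε w =
      (fun k => iotaCoeff n ε k * (w.1 k : ℂ), fun k => iotaCoeff n ε k * (w.2 k : ℂ)) := by
  ext k <;> simp only [iotaEps, iotaCoeff] <;> split_ifs <;> simp

/-- `ι_ε` as a continuous real-linear map. -/
noncomputable def iotaCLM (n : ℕ) (ε : Fin n → ℝ) :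
    ((Fin n → ℝ) × (Fin n → ℝ)) →L[ℝ] ((Fin n → ℂ) × (Fin n → ℂ)) :=
  LinearMap.toContinuousLinearMap
    { toFun := iotaEps n ε
      map_add' := fun u v => by
        simp only [iotaEps_eq]
        ext k <;> simp [mul_add]
      map_smul' := fun c v => by
        simp only [iotaEps_eq]
        ext k <;> simp [mul_left_comm] }

lemma iotaCLM_apply (n : ℕ) (ε : Fin n → ℝ) (w : (Fin n → ℝ) × (Fin n → ℝ)) :
    iotaCLM n ε w = iotaEps n ε w := rfl

lemma iotaEps_single_zero (n : ℕ) (ε : Fin n → ℝ) (k : Fin n) :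
    iotaEps n ε (Pi.single k 1, 0) = iotaCoeff n ε k • (Pi.single k 1, 0) := by
  rw [iotaEps_eq]
  ext j
  · rcases eq_or_ne j k with rfl | h <;> simp [*]
  · simp

lemma iotaEps_zero_single (n : ℕ) (ε : Fin n → ℝ) (k : Fin n) :
    iotaEps n ε (0, Pi.single k 1) = iotaCoeff n ε k • (0, Pi.single k 1) := by
  rw [iotaEps_eq]
  ext j
  · simp
  · rcases eq_or_ne j k with rfl | h <;> simp [*]

/-- The real form is fixed pointwise by `C_ε ∘ σ`. -/
lemma Ceps_sigmaConj_iotaEps {n : ℕ} {ε : Fin n → ℝ} (hε : ∀ k, ε k = 1 ∨ ε k = -1)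
    (w : (Fin n → ℝ) × (Fin n → ℝ)) :
    Ceps n ε (sigmaConj n (iotaEps n ε w)) = iotaEps n ε w := by
  ext k <;> rcases hε k with h | h <;> norm_num [Ceps, sigmaConj, iotaEps, h]

/-- On the real form, the derivative of the restriction of an invariant holomorphic function is
its complex derivative along the embedded direction. -/
lemma ofReal_fderiv_re_comp_iotaEps {n : ℕ} {ε : Fin n → ℝ} (hε : ∀ k, ε k = 1 ∨ ε k = -1)
    {F : (Fin n → ℂ) × (Fin n → ℂ) → ℂ} (hF : Differentiable ℂ F)
    (hFinv : ∀ z, starRingEnd ℂ (F (Ceps n ε (sigmaConj n z))) = F z)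
    (w v : (Fin n → ℝ) × (Fin n → ℝ)) :
    ((fderiv ℝ (fun u => (F (iotaEps n ε u)).re) w v : ℝ) : ℂ) =
      fderiv ℂ F (iotaEps n ε w) (iotaEps n ε v) := by
  have hd : HasFDerivAt (fun u => F (iotaEps n ε u))
      (((fderiv ℂ F (iotaEps n ε w)).restrictScalars ℝ).comp (iotaCLM n ε)) w :=
    ((hF (iotaEps n ε w)).hasFDerivAt.restrictScalars ℝ).comp w (iotaCLM n ε).hasFDerivAt
  have hre := Complex.reCLM.hasFDerivAt.comp w hd
  have hreal : (fun u => (((F (iotaEps n ε u)).re : ℝ) : ℂ)) = fun u => F (iotaEps n ε u) := by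
    funext u
    apply Complex.conj_eq_iff_re.mp
    simpa only [Ceps_sigmaConj_iotaEps hε] using hFinv (iotaEps n ε u)
  have hof : HasFDerivAt (fun u => (((F (iotaEps n ε u)).re : ℝ) : ℂ)) _ w :=
    Complex.ofRealCLM.hasFDerivAt.comp w hre
  rw [hreal] at hof
  have hfd : fderiv ℝ (fun u => (F (iotaEps n ε u)).re) w = _ := hre.fderiv
  rw [hfd]
  exact DFunLike.congr_fun (hof.unique hd) v

/-- The real Hamiltonian form of a Liouville integrable system is Liouville
integrable: if `F`, `G` are holomorphic, invariant under the antiholomorphic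
involution `C̃_ε = C_ε ∘ σ`, and `{F,G}_ℂ = 0` identically, then the restrictions
`F_ℝ = Re (F ∘ ι_ε)`, `G_ℝ = Re (G ∘ ι_ε)` satisfy `{F_ℝ, G_ℝ}_ε = 0`
identically. -/
theorem real_form_integrals_in_involution
    (n : ℕ) (hn : 1 ≤ n) (ε : Fin n → ℝ) (hε : ∀ k, ε k = 1 ∨ ε k = -1)
    (F G : (Fin n → ℂ) × (Fin n → ℂ) → ℂ)
    (hF : Differentiable ℂ F) (hG : Differentiable ℂ G)
    (hFinv : ∀ z, starRingEnd ℂ (F (Ceps n ε (sigmaConj n z))) = F z)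
    (hGinv : ∀ z, starRingEnd ℂ (G (Ceps n ε (sigmaConj n z))) = G z)
    (hFG : ∀ z, complexPB n F G z = 0) :
    ∀ w, realPBeps n ε (fun u => (F (iotaEps n ε u)).re)
      (fun u => (G (iotaEps n ε u)).re) w = 0 := by
  intro w
  have h := hFG (iotaEps n ε w)
  rw [← Complex.ofReal_eq_zero, ← h]
  simp only [realPBeps, complexPB, Complex.ofReal_sum, Complex.ofReal_mul, Complex.ofReal_sub,
    ofReal_fderiv_re_comp_iotaEps hε hF hFinv, ofReal_fderiv_re_comp_iotaEps hε hG hGinv,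
    iotaEps_single_zero, iotaEps_zero_single, map_smul, smul_eq_mul]
  refine Finset.sum_congr rfl fun k _ => ?_
  linear_combination
    (fderiv ℂ F (iotaEps n ε w) (Pi.single k 1, 0) * fderiv ℂ G (iotaEps n ε w) (0, Pi.single k 1)
      - fderiv ℂ F (iotaEps n ε w) (0, Pi.single k 1) *
        fderiv ℂ G (iotaEps n ε w) (Pi.single k 1, 0)) * iotaCoeff_mul_self hε k
end

section
/- Let n ≥ 1 and let p, q : ℝ → Fin n → ℝ be differentiable curves satisfying the Toda chain equations of motion: dq_k/dt = p_k(t) for all k, and dp_k/dt = exp(q_{k+1}(t) − q_k(t)) − exp(q_k(t) − q_{k−1}(t)), where the first term is omitted for k = n and the second for k = 1. Define a_k(t) = (1/2)·exp((q_{k+1}(t) − q_k(t))/2) for 1 ≤ k ≤ n−1, and the real symmetric tridiagonal matrix L(t) with L_{kk} = −p_k(t)/2, L_{k,k+1} = L_{k+1,k} = a_k(t), all other entries 0, and the antisymmetric tridiagonal matrix M(t) with M_{k,k+1} = a_k(t), M_{k+1,k} = −a_k(t), all other entries 0. Then L satisfies the Lax equation dL/dt = L(t)·M(t) − M(t)·L(t)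 for all t. -/
/-- The off-diagonal entries `a_k = (1/2)·exp((q_{k+1} − q_k)/2)` of the Toda Lax
pair (zero when there is no `(k+1)`-st particle). -/
noncomputable def todaA (n : ℕ) (q : Fin n → ℝ) (k : Fin n) : ℝ :=
  if h : (k : ℕ) + 1 < n then Real.exp ((q ⟨(k : ℕ) + 1, h⟩ - q k) / 2) / 2 else 0

/-- The symmetric tridiagonal Toda Lax matrix `L` with `L_{kk} = −p_k/2` and
`L_{k,k+1} = L_{k+1,k} = a_k`. -/
noncomputable def todaLaxL (n : ℕ) (p q : Fin n → ℝ) : Matrix (Fin n) (Fin n) ℝ :=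
  Matrix.of fun i j =>
    if i = j then -(p i) / 2
    else if (i : ℕ) + 1 = (j : ℕ) then todaA n q i
    else if (j : ℕ) + 1 = (i : ℕ) then todaA n q j
    else 0

/-- The antisymmetric tridiagonal Toda matrix `M` with `M_{k,k+1} = a_k`,
`M_{k+1,k} = −a_k`. -/
noncomputable def todaLaxM (n : ℕ) (q : Fin n → ℝ) : Matrix (Fin n) (Fin n) ℝ :=
  Matrix.of fun i j =>
    if (i : ℕ) + 1 = (j : ℕ) then todaA n q i
    else if (j : ℕ) + 1 = (i : ℕ) then -(todaA n q j)
    else 0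

theorem sum_ite_val_add_one_eq_val {n : ℕ} (f : Fin n → ℝ) (j : Fin n) :
    (∑ l : Fin n, if (l : ℕ) + 1 = (j : ℕ) then f l else 0)
      = if 0 < (j : ℕ) then f ⟨(j : ℕ) - 1, Nat.lt_of_le_of_lt (Nat.sub_le _ _) j.2⟩ else 0 := by
  split_ifs with h
  · rw [Finset.sum_eq_single ⟨(j : ℕ) - 1, Nat.lt_of_le_of_lt (Nat.sub_le _ _) j.2⟩]
    · rw [if_pos (Nat.sub_add_cancel h)]
    · intro l _ hl
      rw [if_neg]
      intro h'
      exact hl (Fin.ext (by simp only; omega))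
    · simp
  · exact Finset.sum_eq_zero fun l _ => if_neg (by omega)

theorem sum_ite_val_eq_val_add_one {n : ℕ} (f : Fin n → ℝ) (j : Fin n) :
    (∑ l : Fin n, if (j : ℕ) + 1 = (l : ℕ) then f l else 0)
      = if h : (j : ℕ) + 1 < n then f ⟨(j : ℕ) + 1, h⟩ else 0 := by
  split_ifs with h
  · rw [Finset.sum_eq_single ⟨(j : ℕ) + 1, h⟩]
    · rw [if_pos rfl]
    · intro l _ hl
      rw [if_neg]
      intro h'
      exact hl (Fin.ext h'.symm)
    · simp
  · exact Finset.sum_eq_zero fun l _ => if_neg (by omega)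

theorem todaLaxL_symm {n : ℕ} (p q : Fin n → ℝ) (i j : Fin n) :
    todaLaxL n p q i j = todaLaxL n p q j i := by
  simp only [todaLaxL, Matrix.of_apply]
  grind

theorem todaLaxM_antisymm {n : ℕ} (q : Fin n → ℝ) (i j : Fin n) :
    todaLaxM n q i j = -todaLaxM n q j i := by
  simp only [todaLaxM, Matrix.of_apply]
  grind

theorem mul_todaLaxM_apply {n : ℕ} (B : Matrix (Fin n) (Fin n) ℝ) (q : Fin n → ℝ) (i j : Fin n) :
    (B * todaLaxM n q) i j
      = (if 0 < (j : ℕ) then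
          B i ⟨(j : ℕ) - 1, Nat.lt_of_le_of_lt (Nat.sub_le _ _) j.2⟩
            * todaA n q ⟨(j : ℕ) - 1, Nat.lt_of_le_of_lt (Nat.sub_le _ _) j.2⟩ else 0)
        - (if h : (j : ℕ) + 1 < n then B i ⟨(j : ℕ) + 1, h⟩ * todaA n q j else 0) := by
  rw [← sum_ite_val_add_one_eq_val (fun l => B i l * todaA n q l) j,
    ← sum_ite_val_eq_val_add_one (fun l => B i l * todaA n q j) j, ← Finset.sum_sub_distrib,
    Matrix.mul_apply]
  refine Finset.sum_congr rfl fun l _ => ?_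
  simp only [todaLaxM, Matrix.of_apply]
  split_ifs <;> first | omega | ring

theorem todaLax_commutator_apply {n : ℕ} (p q : Fin n → ℝ) (i j : Fin n) :
    (todaLaxL n p q * todaLaxM n q - todaLaxM n q * todaLaxL n p q) i j
      = (todaLaxL n p q * todaLaxM n q) i j + (todaLaxL n p q * todaLaxM n q) j i := by
  rw [Matrix.sub_apply, sub_eq_add_neg]
  congr 1
  rw [Matrix.mul_apply, Matrix.mul_apply, ← Finset.sum_neg_distrib]
  refine Finset.sum_congr rfl fun l _ => ?_
  rw [todaLaxM_antisymm q i l, todaLaxL_symm p q l j]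
  ring

theorem todaA_sq {n : ℕ} (q : Fin n → ℝ) (k : Fin n) (h : (k : ℕ) + 1 < n) :
    todaA n q k * todaA n q k = Real.exp (q ⟨(k : ℕ) + 1, h⟩ - q k) / 4 := by
  rw [todaA, dif_pos h, ← add_halves (q ⟨(k : ℕ) + 1, h⟩ - q k), Real.exp_add, add_halves]
  ring

theorem todaLaxL_self {n : ℕ} (p q : Fin n → ℝ) (i : Fin n) :
    todaLaxL n p q i i = -(p i) / 2 := by
  simp [todaLaxL]

theorem todaLaxL_of_succ {n : ℕ} (p q : Fin n → ℝ) {i j : Fin n} (h : (i : ℕ) + 1 = (j : ℕ)) :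
    todaLaxL n p q i j = todaA n q i := by
  have hij : i ≠ j := fun e => by subst e; omega
  simp [todaLaxL, hij, h]

theorem todaLaxL_of_add_one_lt {n : ℕ} (p q : Fin n → ℝ) {i j : Fin n}
    (h : (i : ℕ) + 1 < (j : ℕ)) : todaLaxL n p q i j = 0 := by
  have hij : i ≠ j := fun e => by subst e; omega
  simp only [todaLaxL, Matrix.of_apply]
  rw [if_neg hij, if_neg (by omega), if_neg (by omega)]

theorem todaLax_commutator_self {n : ℕ} (p q : Fin n → ℝ) (i : Fin n) :
    (todaLaxL n p q * todaLaxM n q - todaLaxM n q * todaLaxL n p q) i i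
      = -((if h : (i : ℕ) + 1 < n then Real.exp (q ⟨(i : ℕ) + 1, h⟩ - q i) else 0)
        - (if 0 < (i : ℕ) then Real.exp (q i
            - q ⟨(i : ℕ) - 1, Nat.lt_of_le_of_lt (Nat.sub_le _ _) i.2⟩) else 0)) / 2 := by
  have hprev : (if 0 < (i : ℕ) then
          todaLaxL n p q i ⟨(i : ℕ) - 1, Nat.lt_of_le_of_lt (Nat.sub_le _ _) i.2⟩
            * todaA n q ⟨(i : ℕ) - 1, Nat.lt_of_le_of_lt (Nat.sub_le _ _) i.2⟩ else 0)
      = (if 0 < (i : ℕ) then Real.exp (q i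
            - q ⟨(i : ℕ) - 1, Nat.lt_of_le_of_lt (Nat.sub_le _ _) i.2⟩) else 0) / 4 := by
    split_ifs with h
    · have hi : (i : ℕ) - 1 + 1 = i := Nat.sub_add_cancel h
      rw [todaLaxL_symm, todaLaxL_of_succ p q hi, todaA_sq q _ (hi.trans_lt i.2)]
      simp only [hi]
    · simp
  have hnext : (if h : (i : ℕ) + 1 < n then
          todaLaxL n p q i ⟨(i : ℕ) + 1, h⟩ * todaA n q i else 0)
      = (if h : (i : ℕ) + 1 < n then Real.exp (q ⟨(i : ℕ) + 1, h⟩ - q i) else 0) / 4 := by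
    split_ifs with h
    · rw [todaLaxL_of_succ p q rfl, todaA_sq q i h]
    · simp
  rw [todaLax_commutator_apply, mul_todaLaxM_apply, hprev, hnext]
  ring

theorem todaLax_commutator_of_succ {n : ℕ} (p q : Fin n → ℝ) {i j : Fin n}
    (h : (i : ℕ) + 1 = (j : ℕ)) :
    (todaLaxL n p q * todaLaxM n q - todaLaxM n q * todaLaxL n p q) i j
      = todaA n q i * ((p j - p i) / 2) := by
  have hi : (i : ℕ) + 1 < n := h.trans_lt j.2
  have hj : (⟨(i : ℕ) + 1, hi⟩ : Fin n) = j := Fin.ext h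
  have hj' : (⟨(j : ℕ) - 1, Nat.lt_of_le_of_lt (Nat.sub_le _ _) j.2⟩ : Fin n) = i :=
    Fin.ext (by simp only; omega)
  rw [todaLax_commutator_apply, mul_todaLaxM_apply, mul_todaLaxM_apply, if_pos (by omega),
    dif_pos hi, hj, hj', todaLaxL_self, todaLaxL_self]
  have hnext : (if h : (j : ℕ) + 1 < n then
      todaLaxL n p q i ⟨(j : ℕ) + 1, h⟩ * todaA n q j else 0) = 0 := by
    split_ifs with hlt
    · rw [todaLaxL_of_add_one_lt p q (by simp only; omega), zero_mul]
    · rfl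
  have hprev : (if 0 < (i : ℕ) then
      todaLaxL n p q j ⟨(i : ℕ) - 1, Nat.lt_of_le_of_lt (Nat.sub_le _ _) i.2⟩
        * todaA n q ⟨(i : ℕ) - 1, Nat.lt_of_le_of_lt (Nat.sub_le _ _) i.2⟩ else 0) = 0 := by
    split_ifs with hlt
    · rw [todaLaxL_symm, todaLaxL_of_add_one_lt p q (by simp only; omega), zero_mul]
    · rfl
  rw [hnext, hprev]
  ring

theorem todaLax_commutator_of_add_one_lt {n : ℕ} (p q : Fin n → ℝ) {i j : Fin n}
    (h : (i : ℕ) + 1 < (j : ℕ)) :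
    (todaLaxL n p q * todaLaxM n q - todaLaxM n q * todaLaxL n p q) i j = 0 := by
  have hi : (i : ℕ) + 1 < n := h.trans j.2
  have hnext : (if h : (j : ℕ) + 1 < n then
      todaLaxL n p q i ⟨(j : ℕ) + 1, h⟩ * todaA n q j else 0) = 0 := by
    split_ifs with hlt
    · rw [todaLaxL_of_add_one_lt p q (by simp only; omega), zero_mul]
    · rfl
  have hprev : (if 0 < (i : ℕ) then
      todaLaxL n p q j ⟨(i : ℕ) - 1, Nat.lt_of_le_of_lt (Nat.sub_le _ _) i.2⟩
        * todaA n q ⟨(i : ℕ) - 1, Nat.lt_of_le_of_lt (Nat.sub_le _ _) i.2⟩ else 0) = 0 := by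
    split_ifs with hlt
    · rw [todaLaxL_symm, todaLaxL_of_add_one_lt p q (by simp only; omega), zero_mul]
    · rfl
  rw [todaLax_commutator_apply, mul_todaLaxM_apply, mul_todaLaxM_apply, hnext, hprev,
    if_pos (by omega), dif_pos hi, todaLaxL_symm p q j]
  rcases Nat.lt_or_ge ((i : ℕ) + 2) j with hlt | hge
  · rw [todaLaxL_of_add_one_lt p q (by simp only; omega),
      todaLaxL_of_add_one_lt p q (by simp only; omega)]
    ring
  · have hm : (⟨(j : ℕ) - 1, Nat.lt_of_le_of_lt (Nat.sub_le _ _) j.2⟩ : Fin n)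
        = ⟨(i : ℕ) + 1, hi⟩ := Fin.ext (by simp only; omega)
    rw [hm, todaLaxL_of_succ p q rfl, todaLaxL_of_succ p q (by simp only; omega)]
    ring

theorem hasDerivAt_todaA {n : ℕ} {q : ℝ → Fin n → ℝ} {q' : Fin n → ℝ} {t : ℝ}
    (hq : ∀ k, HasDerivAt (fun s => q s k) (q' k) t) {i j : Fin n} (h : (i : ℕ) + 1 = (j : ℕ)) :
    HasDerivAt (fun s => todaA n (q s) i) (todaA n (q t) i * ((q' j - q' i) / 2)) t := by
  have hi : (i : ℕ) + 1 < n := h.trans_lt j.2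
  have hj : (⟨(i : ℕ) + 1, hi⟩ : Fin n) = j := Fin.ext h
  simp only [todaA, dif_pos hi, hj]
  refine ((((hq j).sub (hq i)).div_const 2).exp.div_const 2).congr_deriv ?_
  exact mul_div_right_comm _ _ _

/-- Along any solution of the Toda chain equations of motion
`dq_k/dt = p_k`, `dp_k/dt = e^{q_{k+1}−q_k} − e^{q_k−q_{k−1}}` (boundary terms
omitted), the matrix `L` satisfies the Lax equation `dL/dt = L·M − M·L`. -/
theorem toda_lax_equation
    (n : ℕ) (hn : 1 ≤ n) (p q : ℝ → Fin n → ℝ)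
    (hq : ∀ (t : ℝ) (k : Fin n), HasDerivAt (fun s => q s k) (p t k) t)
    (hp : ∀ (t : ℝ) (k : Fin n), HasDerivAt (fun s => p s k)
      ((if h : (k : ℕ) + 1 < n
          then Real.exp (q t ⟨(k : ℕ) + 1, h⟩ - q t k) else 0)
        - (if 0 < (k : ℕ)
          then Real.exp (q t k
            - q t ⟨(k : ℕ) - 1, Nat.lt_of_le_of_lt (Nat.sub_le _ _) k.2⟩) else 0)) t) :
    ∀ (t : ℝ) (i j : Fin n),
      HasDerivAt (fun s => todaLaxL n (p s) (q s) i j)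
        ((todaLaxL n (p t) (q t) * todaLaxM n (q t)
          - todaLaxM n (q t) * todaLaxL n (p t) (q t)) i j) t := by
  intro t i j
  wlog hij : (i : ℕ) ≤ j generalizing i j
  · have hji := this j i (by omega)
    rw [todaLax_commutator_apply, add_comm, ← todaLax_commutator_apply]
    exact hji.congr_of_eventuallyEq
      (Filter.Eventually.of_forall fun s => todaLaxL_symm (p s) (q s) i j)
  rcases hij.eq_or_lt with heq | hlt
  · obtain rfl : i = j := Fin.ext heq
    simp only [todaLaxL_self]
    rw [todaLax_commutator_self]
    exact (hp t i).neg.div_const 2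
  rcases (Nat.succ_le_of_lt hlt).eq_or_lt with heq | hlt'
  · simp only [todaLaxL_of_succ _ _ heq]
    rw [todaLax_commutator_of_succ _ _ heq]
    exact hasDerivAt_todaA (hq t) heq
  · simp only [todaLaxL_of_add_one_lt _ _ hlt']
    rw [todaLax_commutator_of_add_one_lt _ _ hlt']
    exact hasDerivAt_const t 0
end

section
/- Let n ≥ 1 and p, q : Fin n → ℂ. Define the complex Toda Lax matrix L(p,q) ∈ Matrix (Fin n) (Fin n) ℂ as the symmetric tridiagonal matrix with L_{kk} = −p_k/2, L_{k,k+1} = L_{k+1,k} = a_k = (1/2)·exp((q_{k+1} − q_k)/2), all other entries 0. Let C̃ act by (C̃ p)_k = −conj(p_{n+1−k}), (C̃ q)_k = −conj(q_{n+1−k}), and let S₀ ∈ Matrix (Fin n) (Fin n) ℂ be the antidiagonal matrix with (S₀)_{j,n+1−j} = (−1)^{j+1} and all other entries 0. Then S₀ · L(C̃ p, C̃ q) = −(L(p,q))ᴴ · S₀, where ᴴ denotes the conjugate transpose; i.e. the involution C̃ of the complexified Toda phase space induces a Cartan-like involution of the Lax matrix. -/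
open Matrix

/-- The complex symmetric tridiagonal Toda Lax matrix with `L_{kk} = −p_k/2` and
`L_{k,k+1} = L_{k+1,k} = a_k = (1/2)·exp((q_{k+1} − q_k)/2)`. -/
noncomputable def todaLaxC (n : ℕ) (p q : Fin n → ℂ) : Matrix (Fin n) (Fin n) ℂ :=
  Matrix.of fun j k =>
    if j = k then -(p j) / 2
    else if (j : ℕ) + 1 = (k : ℕ) then
      (if h : (j : ℕ) + 1 < n
        then Complex.exp ((q ⟨(j : ℕ) + 1, h⟩ - q j) / 2) / 2 else 0)
    else if (k : ℕ) + 1 = (j : ℕ) then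
      (if h : (k : ℕ) + 1 < n
        then Complex.exp ((q ⟨(k : ℕ) + 1, h⟩ - q k) / 2) / 2 else 0)
    else 0

/-- Entrywise, reversing both indices and conjugating the phase point conjugates the transposed
Lax matrix up to the sign `-(-1)^(j - m)`. -/
theorem todaLaxC_rev_rev (n : ℕ) (p q : Fin n → ℂ) (j m : Fin n) :
    (-1 : ℂ) ^ (j : ℕ) * todaLaxC n (fun k => -(starRingEnd ℂ) (p k.rev))
        (fun k => -(starRingEnd ℂ) (q k.rev)) j.rev m.rev
      = -(starRingEnd ℂ) (todaLaxC n p q m j) * (-1 : ℂ) ^ (m : ℕ) := by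
  have hj := j.isLt
  have hm := m.isLt
  have hjr := Fin.val_rev j
  have hmr := Fin.val_rev m
  by_cases h0 : m = j
  · subst h0
    simp only [todaLaxC, Matrix.of_apply, if_true, Fin.rev_rev, map_div₀, map_neg, Complex.conj_ofNat]
    ring
  have h0' : (m : ℕ) ≠ j := fun h => h0 (Fin.ext h)
  have h0r : j.rev ≠ m.rev := fun h => h0 (Fin.rev_injective h).symm
  by_cases h1 : (m : ℕ) + 1 = j
  · have hr : (j.rev : ℕ) + 1 = m.rev := by omega
    have e1 : (⟨(j.rev : ℕ) + 1, hr ▸ m.rev.isLt⟩ : Fin n) = m.rev := Fin.ext hr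
    have e2 : (⟨(m : ℕ) + 1, h1 ▸ hj⟩ : Fin n) = j := Fin.ext h1
    have l1 : (j.rev : ℕ) + 1 < n := hr ▸ m.rev.isLt
    have l2 : (m : ℕ) + 1 < n := h1 ▸ hj
    simp only [todaLaxC, Matrix.of_apply, if_neg h0, if_neg h0r, if_pos h1, if_pos hr,
      dif_pos l1, dif_pos l2, e1, e2, Fin.rev_rev, map_div₀, ← Complex.exp_conj, map_sub,
      Complex.conj_ofNat]
    rw [← h1, pow_succ, neg_sub_neg]
    ring
  by_cases h2 : (j : ℕ) + 1 = m
  · have hr : (m.rev : ℕ) + 1 = j.rev := by omega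
    have hr' : (j.rev : ℕ) + 1 ≠ m.rev := by omega
    have e1 : (⟨(m.rev : ℕ) + 1, hr ▸ j.rev.isLt⟩ : Fin n) = j.rev := Fin.ext hr
    have e2 : (⟨(j : ℕ) + 1, h2 ▸ hm⟩ : Fin n) = m := Fin.ext h2
    have l1 : (m.rev : ℕ) + 1 < n := hr ▸ j.rev.isLt
    have l2 : (j : ℕ) + 1 < n := h2 ▸ hm
    simp only [todaLaxC, Matrix.of_apply, if_neg h0, if_neg h0r, if_neg h1, if_neg hr',
      if_pos h2, if_pos hr, dif_pos l1, dif_pos l2, e1, e2, Fin.rev_rev, map_div₀,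
      ← Complex.exp_conj, map_sub, Complex.conj_ofNat]
    rw [← h2, pow_succ, neg_sub_neg]
    ring
  · have hr : (m.rev : ℕ) + 1 ≠ j.rev := by omega
    have hr' : (j.rev : ℕ) + 1 ≠ m.rev := by omega
    simp [todaLaxC, h0, h0r, h1, h2, hr, hr', -Fin.val_rev, -Fin.rev_inj]

/-- The involution `C̃ : (p,q) ↦ (−conj p ∘ rev, −conj q ∘ rev)` of the
complexified Toda phase space induces a Cartan-like involution of the Lax
matrix: `S₀ · L(C̃p, C̃q) = −Lᴴ · S₀`, where `S₀` is the antidiagonal matrix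
with entries `(S₀)_{j, n+1−j} = (−1)^{j+1}`. -/
theorem toda_lax_cartan_involution
    (n : ℕ) (hn : 1 ≤ n) (p q : Fin n → ℂ)
    (S₀ : Matrix (Fin n) (Fin n) ℂ)
    (hS₀ : S₀ = Matrix.of fun j k : Fin n => if k = j.rev then (-1 : ℂ) ^ (j : ℕ) else 0) :
    S₀ * todaLaxC n (fun k => -(starRingEnd ℂ) (p k.rev))
        (fun k => -(starRingEnd ℂ) (q k.rev))
      = -(todaLaxC n p q)ᴴ * S₀ := by
  subst hS₀
  ext j k
  have hk : ∀ m : Fin n, k = m.rev ↔ m = k.rev := fun m =>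
    ⟨fun h => by rw [h, Fin.rev_rev], fun h => by rw [h, Fin.rev_rev]⟩
  have key := todaLaxC_rev_rev n p q j k.rev
  rw [Fin.rev_rev] at key
  simp only [Matrix.mul_apply, Matrix.of_apply, hk, ite_mul, mul_ite, zero_mul, mul_zero,
    Finset.sum_ite_eq', Finset.mem_univ, if_true, Matrix.neg_apply, Matrix.conjTranspose_apply]
  exact key
end

section
/- Let n ≥ 1, g ∈ ℝ, let x : ℝ → ℝ be an odd function (x(−ξ) = −x(ξ) for all ξ), and let p, q : Fin n → ℝ. Define the Calogero–Moser Lax matrix L(p,q) ∈ Matrix (Fin n) (Fin n) ℂ by L_{jj} = p_j and L_{jk} = i·g·x(q_j − q_k) for j ≠ k. Define the involution C by (C p)_k = −p_{n+1−k}, (C q)_k = −q_{n+1−k}, and let T ∈ Matrix (Fin n) (Fin n) ℂ be the reversal permutation matrix with T_{j,n+1−j} = 1 and all other entries 0. Then T · L(C p, C q) · T = −(L(p,q))ᴴ, where ᴴ denotes the conjugate transpose; i.e. the involution C of the phase space induces a Cartan-like involution of the Calogero–Moser Lax representation. -/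
open Matrix

/-- The Calogero–Moser Lax matrix: `L_{jj} = p_j`, `L_{jk} = i·g·x(q_j − q_k)`
for `j ≠ k`. -/
noncomputable def cmLax (n : ℕ) (g : ℝ) (x : ℝ → ℝ) (p q : Fin n → ℝ) :
    Matrix (Fin n) (Fin n) ℂ :=
  Matrix.of fun j k =>
    if j = k then (p j : ℂ) else Complex.I * (g : ℂ) * (x (q j - q k) : ℂ)

/-- Conjugating a matrix by the reversal permutation matrix reverses both indices. -/
theorem reversal_mul_mul_reversal_apply {R : Type*} [NonAssocSemiring R] {n : ℕ}
    (A : Matrix (Fin n) (Fin n) R) (j k : Fin n) :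
    ((Matrix.of fun a b : Fin n => if b = a.rev then (1 : R) else 0) * A *
      (Matrix.of fun a b : Fin n => if b = a.rev then (1 : R) else 0)) j k =
      A j.rev k.rev := by
  have h (a : Fin n) : k = a.rev ↔ a = k.rev := by rw [eq_comm, Fin.rev_eq_iff]
  simp [Matrix.mul_apply, h]

/-- The involution `C : (p,q) ↦ (−p ∘ rev, −q ∘ rev)` of the phase space induces
a Cartan-like involution of the Calogero–Moser Lax representation:
`T · L(Cp, Cq) · T = −Lᴴ`, where `T` is the reversal permutation matrix and `x`
is odd. -/
theorem calogero_moser_lax_cartan_involution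
    (n : ℕ) (hn : 1 ≤ n) (g : ℝ) (x : ℝ → ℝ)
    (hx : ∀ ξ : ℝ, x (-ξ) = -x ξ)
    (p q : Fin n → ℝ)
    (T : Matrix (Fin n) (Fin n) ℂ)
    (hT : T = Matrix.of fun j k : Fin n => if k = j.rev then (1 : ℂ) else 0) :
    T * cmLax n g x (fun k => -p k.rev) (fun k => -q k.rev) * T
      = -(cmLax n g x p q)ᴴ := by
  subst hT
  ext j k
  rw [reversal_mul_mul_reversal_apply]
  by_cases h : j = k
  · subst h
    simp [cmLax]
  · simp [cmLax, h, Ne.symm h, sub_eq_add_neg, add_comm]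
end
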